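/- arXiv:2106.01190 — 5 statements merged into one kernel-verified Lean document; each statement's English description precedes it below -/
import Mathlib

section
/- Let σ and n be positive integers with σ < n, and write n = mσ + p with 0 ≤ p < σ. Then the maximum, over all strings w of length n over a totally ordered alphabet of size σ, of the total number of occurrences of Lyndon subsequences in w (i.e., the number of nonempty subsequence occurrences, counted with multiplicity of occurrence, whose underlying word is a Lyndon word) equals 2^n − (p + σ)·2^m + n + σ − 1. -/
/-- A nonempty string is a Lyndon word if it is lexicographically strictly smaller
than all of its nonempty proper suffixes. -/
def IsLyndon {α : Type*} [LinearOrder α] (w : List α) : Prop :=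
  w ≠ [] ∧ ∀ i, 0 < i → i < w.length → List.Lex (· < ·) w (w.drop i)

/-- The subsequence of `w` extracted at the set of positions `S` (taken in increasing order). -/
def subseqAt {α : Type*} (w : List α) (S : Finset (Fin w.length)) : List α :=
  (S.sort (· ≤ ·)).map w.get

/-- The total number of occurrences of Lyndon subsequences in `w`: the number of
(nonempty) sets of positions whose extracted word is a Lyndon word. -/
noncomputable def totalLyndonSubseq {α : Type*} [LinearOrder α] (w : List α) : ℕ :=
  Nat.card {S : Finset (Fin w.length) // IsLyndon (subseqAt w S)}

theorem not_lex_replicate_of_le {α : Type*} [LinearOrder α] (c : α) (k j : ℕ) (h : j ≤ k) :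
    ¬ List.Lex (· < ·) (List.replicate k c) (List.replicate j c) := by
  induction j generalizing k with
  | zero => simp
  | succ j ih =>
    obtain ⟨k, rfl⟩ : ∃ i, k = i + 1 := ⟨k - 1, by omega⟩
    simpa [List.replicate_succ] using ih k (by omega)

theorem not_isLyndon_replicate {α : Type*} [LinearOrder α] (c : α) (k : ℕ) (h : 2 ≤ k) :
    ¬ IsLyndon (List.replicate k c) := by
  rintro ⟨-, hl⟩
  have := hl 1 (by omega) (by rwa [List.length_replicate])
  rw [List.drop_replicate] at this
  exact not_lex_replicate_of_le c k (k - 1) (by omega) this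

theorem lex_drop_of_pairwise_le {α : Type*} [LinearOrder α] (l : List α)
    (hs : l.Pairwise (· ≤ ·)) (hc : ∃ x ∈ l, ∃ y ∈ l, x ≠ y) (i : ℕ) (hi : 0 < i)
    (hil : i < l.length) : List.Lex (· < ·) l (l.drop i) := by
  induction l with
  | nil => simp at hil
  | cons a t ih =>
    obtain ⟨j, rfl⟩ : ∃ j, i = j + 1 := ⟨i - 1, by omega⟩
    rw [List.pairwise_cons] at hs
    have hj : j < t.length := by simpa using hil
    rw [List.drop_succ_cons, List.drop_eq_getElem_cons hj]
    rcases (hs.1 t[j] (List.getElem_mem hj)).lt_or_eq with h | h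
    · exact List.Lex.rel h
    · rw [← h]
      have hc' : ∃ x ∈ t, a ≠ x := by grind
      obtain ⟨x, hx, hax⟩ := hc'
      have hlast : j + 1 < t.length := by
        by_contra hcon
        obtain ⟨q, hq, rfl⟩ := List.getElem_of_mem hx
        have hqj : t[q] ≤ t[j] := by
          rcases (show q ≤ j by omega).lt_or_eq with hlt | rfl
          · exact List.pairwise_iff_getElem.1 hs.2 q j hq hj hlt
          · exact le_rfl
        exact hax (le_antisymm (hs.1 _ hx) (h ▸ hqj))
      exact List.Lex.cons (ih hs.2 ⟨_, List.getElem_mem hj, x, hx, h ▸ hax⟩ hlast)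

theorem mem_subseqAt {α : Type*} (w : List α) (S : Finset (Fin w.length)) (x : α) :
    x ∈ subseqAt w S ↔ ∃ i ∈ S, w.get i = x := by
  simp [subseqAt]

theorem length_subseqAt {α : Type*} (w : List α) (S : Finset (Fin w.length)) :
    (subseqAt w S).length = S.card := by
  simp [subseqAt]

theorem IsLyndon.card_eq_one_or {α : Type*} [LinearOrder α] {w : List α}
    {S : Finset (Fin w.length)} (h : IsLyndon (subseqAt w S)) :
    S.card = 1 ∨ ¬ ∃ c, ∀ i ∈ S, w.get i = c := by
  by_contra! hcon
  obtain ⟨hcard, c, hc⟩ := hcon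
  have hrep : subseqAt w S = List.replicate S.card c := by
    rw [List.eq_replicate_iff, length_subseqAt]
    refine ⟨rfl, fun x hx => ?_⟩
    obtain ⟨i, hi, rfl⟩ := (mem_subseqAt w S x).1 hx
    exact hc i hi
  have hpos : 0 < S.card := by
    rw [← length_subseqAt w S]
    exact List.length_pos_of_ne_nil h.1
  rw [hrep] at h
  exact not_isLyndon_replicate c S.card (by omega) h

theorem pairwise_subseqAt {α : Type*} [LinearOrder α] {w : List α} (hw : w.Pairwise (· ≤ ·))
    (S : Finset (Fin w.length)) : (subseqAt w S).Pairwise (· ≤ ·) := by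
  refine List.Pairwise.map _ (fun i j hij => ?_) (S.pairwise_sort (· ≤ ·))
  rcases hij.lt_or_eq with h | rfl
  · exact List.pairwise_iff_get.1 hw i j h
  · exact le_rfl

theorem isLyndon_subseqAt_iff_of_pairwise_le {α : Type*} [LinearOrder α] [Nonempty α] {w : List α}
    (hw : w.Pairwise (· ≤ ·)) (S : Finset (Fin w.length)) :
    IsLyndon (subseqAt w S) ↔ S.card = 1 ∨ ¬ ∃ c, ∀ i ∈ S, w.get i = c := by
  refine ⟨IsLyndon.card_eq_one_or, fun h => ?_⟩
  rcases h with h | h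
  · rw [← length_subseqAt w S] at h
    exact ⟨by rintro h0; simp [h0] at h, fun i hi hil => by omega⟩
  · have hS : S.Nonempty := by
      rw [Finset.nonempty_iff_ne_empty]
      rintro rfl
      exact h (by simp)
    obtain ⟨i, hi⟩ := hS
    push Not at h
    obtain ⟨j, hj, hij⟩ := h (w.get i)
    have hmi := (mem_subseqAt w S _).2 ⟨i, hi, rfl⟩
    have hmj := (mem_subseqAt w S _).2 ⟨j, hj, rfl⟩
    exact ⟨List.ne_nil_of_mem hmi, lex_drop_of_pairwise_le _ (pairwise_subseqAt hw S)
      ⟨_, hmj, _, hmi, hij⟩⟩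

/-- The number of subsets of `ι` that are singletons or on which `f` is not constant. -/
theorem card_singleton_or_nonconstant {ι κ : Type*} [Fintype ι] [DecidableEq ι] [Fintype κ]
    [DecidableEq κ] [Nonempty κ] (f : ι → κ) :
    Nat.card {S : Finset ι // S.card = 1 ∨ ¬ ∃ c, ∀ i ∈ S, f i = c}
      + ∑ c, 2 ^ (Finset.univ.filter fun i => f i = c).card + 1
      = 2 ^ Fintype.card ι + Fintype.card ι + Fintype.card κ := by
  classical
  set M : Finset (Finset ι) := Finset.univ.filter fun S => ∃ c, ∀ i ∈ S, f i = c with hM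
  have hgood : Nat.card {S : Finset ι // S.card = 1 ∨ ¬ ∃ c, ∀ i ∈ S, f i = c}
      = Fintype.card ι + Mᶜ.card := by
    rw [Nat.card_eq_fintype_card, Fintype.card_subtype, Finset.filter_or,
      Finset.card_union_of_disjoint]
    · congr 1
      · have := Finset.card_powersetCard 1 (Finset.univ : Finset ι)
        simp only [Nat.choose_one_right, Finset.card_univ] at this
        rw [← this]
        congr 1
        ext S
        simp [Finset.mem_powersetCard]
      · congr 1
        ext S
        simp [hM]
    · rw [Finset.disjoint_filter]
      intro S _ hS hcon
      obtain ⟨i, rfl⟩ := Finset.card_eq_one.1 hS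
      exact hcon ⟨f i, by simp⟩
  have hcompl : M.card + Mᶜ.card = 2 ^ Fintype.card ι := by
    rw [Finset.card_add_card_compl, Fintype.card_finset]
  have hunion : M.erase ∅ = Finset.univ.biUnion fun c =>
      ((Finset.univ.filter fun i => f i = c).powerset.erase ∅) := by
    ext S
    simp [hM, Finset.subset_iff]
  have hcard : (M.erase ∅).card
      = ∑ c, ((Finset.univ.filter fun i => f i = c).powerset.erase ∅).card := by
    rw [hunion, Finset.card_biUnion]
    intro c _ d _ hcd
    rw [Function.onFun, Finset.disjoint_left]
    intro S hS hS'
    simp only [Finset.mem_erase, Finset.mem_powerset] at hS hS'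
    obtain ⟨i, hi⟩ := Finset.nonempty_iff_ne_empty.2 hS.1
    exact hcd ((by simpa using hS.2 hi : f i = c).symm.trans (by simpa using hS'.2 hi))
  have hsum : ∑ c, ((Finset.univ.filter fun i => f i = c).powerset.erase ∅).card
      + Fintype.card κ = ∑ c, 2 ^ (Finset.univ.filter fun i => f i = c).card := by
    rw [← Finset.card_univ, Finset.card_eq_sum_ones, ← Finset.sum_add_distrib]
    refine Finset.sum_congr rfl fun c _ => ?_
    rw [Finset.card_erase_add_one (Finset.empty_mem_powerset _), Finset.card_powerset]
  have hempty : (M.erase ∅).card + 1 = M.card :=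
    Finset.card_erase_add_one (by simp [hM])
  omega

theorem add_mul_two_pow_le (m k : ℕ) : (k + 1) * 2 ^ m ≤ 2 ^ k + m * 2 ^ m := by
  rcases le_total k m with h | h
  · obtain ⟨d, rfl⟩ := Nat.exists_eq_add_of_le h
    rcases d with _ | d
    · simp [add_mul, add_comm]
    · nlinarith [Nat.zero_le (2 ^ k), Nat.zero_le (d * 2 ^ (k + (d + 1)))]
  · obtain ⟨d, rfl⟩ := Nat.exists_eq_add_of_le h
    have : d + 1 ≤ 2 ^ d := Nat.lt_two_pow_self
    rw [pow_add]
    nlinarith [Nat.mul_le_mul_left (2 ^ m) this]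

theorem add_mul_two_pow_le_sum {κ : Type*} [Fintype κ] (m p : ℕ) (k : κ → ℕ)
    (hk : ∑ c, k c = m * Fintype.card κ + p) :
    (p + Fintype.card κ) * 2 ^ m ≤ ∑ c, 2 ^ k c := by
  have h := Finset.sum_le_sum fun c (_ : c ∈ Finset.univ) => add_mul_two_pow_le m (k c)
  rw [← Finset.sum_mul, Finset.sum_add_distrib, Finset.sum_add_distrib, hk] at h
  simp only [Finset.sum_const, Finset.card_univ, smul_eq_mul, mul_one] at h
  nlinarith

/-- The sorted word containing each letter `c` exactly `k c` times. -/
def sortedWord {σ : ℕ} (k : Fin σ → ℕ) : List (Fin σ) :=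
  (List.finRange σ).flatMap fun c => List.replicate (k c) c

theorem pairwise_sortedWord {σ : ℕ} (k : Fin σ → ℕ) : (sortedWord k).Pairwise (· ≤ ·) := by
  rw [sortedWord, List.pairwise_flatMap]
  refine ⟨fun c _ => List.pairwise_replicate.2 (Or.inr le_rfl), ?_⟩
  refine (List.pairwise_lt_finRange σ).imp fun {a b} hab x hx y hy => ?_
  rw [List.eq_of_mem_replicate hx, List.eq_of_mem_replicate hy]
  exact hab.le

theorem length_sortedWord {σ : ℕ} (k : Fin σ → ℕ) : (sortedWord k).length = ∑ c, k c := by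
  simp [sortedWord, List.length_flatMap, Fin.sum_univ_def]

theorem count_sortedWord {σ : ℕ} (k : Fin σ → ℕ) (c : Fin σ) : (sortedWord k).count c = k c := by
  rw [sortedWord, List.count_flatMap]
  simp [Function.comp_def, List.count_replicate, ← Fin.sum_univ_def]

theorem card_filter_get_eq {α : Type*} [DecidableEq α] (w : List α) (c : α) :
    (Finset.univ.filter fun i : Fin w.length => w.get i = c).card = w.count c := by
  have h := Fin.card_filter_univ_eq_vector_get_eq_count c (⟨w, rfl⟩ : List.Vector α w.length)
  simpa [List.Vector.get, eq_comm] using h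

theorem sum_ite_val_lt {σ p : ℕ} (hp : p < σ) (a b : ℕ) :
    ∑ c : Fin σ, (if c.val < p then a else b) = p * a + (σ - p) * b := by
  rw [Finset.sum_ite, Finset.sum_const, Finset.sum_const]
  have h := Finset.card_filter_add_card_filter_not (s := (Finset.univ : Finset (Fin σ)))
    (fun c => c.val < p)
  have h' : (Finset.univ.filter fun c : Fin σ => c.val < p).card = p := by
    rw [Fin.card_filter_val_lt]; omega
  rw [h', Finset.card_univ, Fintype.card_fin] at h
  rw [h', show (Finset.univ.filter fun c : Fin σ => ¬ c.val < p).card = σ - p by omega]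
  simp

theorem maximum_total_lyndon_subsequences (σ n m p : ℕ) (hσ : 0 < σ) (hσn : σ < n)
    (hn : n = m * σ + p) (hp : p < σ) :
    IsGreatest {k | ∃ w : List (Fin σ), w.length = n ∧ totalLyndonSubseq w = k}
      (2 ^ n - (p + σ) * 2 ^ m + n + σ - 1) := by
  have : Nonempty (Fin σ) := ⟨⟨0, hσ⟩⟩
  obtain ⟨d, rfl⟩ : ∃ d, σ = p + d := Nat.exists_eq_add_of_le hp.le
  have hm : 1 ≤ m := by
    rcases m with _ | m <;> omega
  have hpow : (p + (p + d)) * 2 ^ m ≤ 2 ^ n := by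
    have hle : p + (p + d) + m ≤ n + 1 := by nlinarith
    have hlt : p + (p + d) ≤ 2 ^ (n - m) := by
      have := @Nat.lt_two_pow_self (n - m)
      omega
    calc (p + (p + d)) * 2 ^ m ≤ 2 ^ (n - m) * 2 ^ m := Nat.mul_le_mul_right _ hlt
      _ = 2 ^ n := by rw [← pow_add]; congr 1; omega
  refine ⟨?_, ?_⟩
  · let k : Fin (p + d) → ℕ := fun c => if c.val < p then m + 1 else m
    have hlen : (sortedWord k).length = n := by
      rw [length_sortedWord, sum_ite_val_lt hp, hn, Nat.add_sub_cancel_left]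
      ring
    refine ⟨sortedWord k, hlen, ?_⟩
    have hcount := card_singleton_or_nonconstant (sortedWord k).get
    simp_rw [card_filter_get_eq, count_sortedWord] at hcount
    have hsum : ∑ c, 2 ^ k c = (p + (p + d)) * 2 ^ m := by
      simp only [k, apply_ite (2 ^ ·)]
      rw [sum_ite_val_lt hp, Nat.add_sub_cancel_left]
      ring
    simp only [totalLyndonSubseq, isLyndon_subseqAt_iff_of_pairwise_le (pairwise_sortedWord k)]
    rw [hsum, Fintype.card_fin, Fintype.card_fin] at hcount
    have hlen' : 2 ^ (sortedWord k).length = 2 ^ n := by rw [hlen]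
    omega
  · rintro _ ⟨w, hw, rfl⟩
    have hcount := card_singleton_or_nonconstant w.get
    have hle : totalLyndonSubseq w
        ≤ Nat.card {S : Finset (Fin w.length) // S.card = 1 ∨ ¬ ∃ c, ∀ i ∈ S, w.get i = c} :=
      Nat.card_le_card_of_injective (Subtype.map id fun _ => IsLyndon.card_eq_one_or)
        (Subtype.map_injective _ Function.injective_id)
    have hfib : ∑ c, (Finset.univ.filter fun i => w.get i = c).card
        = m * Fintype.card (Fin (p + d)) + p := by
      rw [← Finset.card_eq_sum_card_fiberwise (fun _ _ => Finset.mem_coe.2 (Finset.mem_univ _)),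
        Finset.card_univ, Fintype.card_fin, Fintype.card_fin, hw, hn]
    have hconv := add_mul_two_pow_le_sum m p _ hfib
    rw [Fintype.card_fin, Fintype.card_fin] at hcount
    have hw' : 2 ^ w.length = 2 ^ n := by rw [hw]
    rw [Fintype.card_fin] at hconv
    omega
end

section
/- Fix a totally ordered alphabet Σ of size σ, and for a string x let C(n, Σ, x) denote the number of strings of length n over Σ that contain x as a subsequence. Then for any two strings x₁, x₂ of the same length m (with m ≤ n), C(n, Σ, x₁) = C(n, Σ, x₂). -/
/-- Words of equal length are matched by a permutation of the words of length `n` that carries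
the words containing one as a subsequence to those containing the other. -/
theorem exists_perm_sublist_ofFn_iff {α : Type*} [DecidableEq α] (n : ℕ) (x y : List α)
    (h : x.length = y.length) :
    ∃ e : Equiv.Perm (Fin n → α),
      ∀ w, x.Sublist (List.ofFn w) ↔ y.Sublist (List.ofFn (e w)) := by
  induction n generalizing x y with
  | zero =>
    refine ⟨Equiv.refl _, fun w => ?_⟩
    simp [← List.length_eq_zero_iff, h]
  | succ n ih =>
    match x, y, h with
    | [], [], _ => exact ⟨Equiv.refl _, by simp⟩
    | a :: s, b :: t, h =>
      obtain ⟨e₀, he₀⟩ := ih s t (by simpa using h)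
      obtain ⟨e₁, he₁⟩ := ih (a :: s) (b :: t) h
      let cons := Fin.consEquiv (fun _ : Fin (n + 1) => α)
      let shear := Equiv.prodShear (Equiv.swap a b) (fun c => if c = a then e₀ else e₁)
      refine ⟨(cons.symm.trans shear).trans cons, fun w => ?_⟩
      obtain ⟨⟨c, v⟩, rfl⟩ := cons.surjective w
      by_cases hc : c = a
      · subst hc
        simp [cons, shear, Fin.consEquiv, he₀]
      · have hb : b ≠ Equiv.swap a b c := fun hb =>
          hc ((Equiv.swap a b).injective (by rw [← hb, Equiv.swap_apply_left]))
        have cons_sublist {d d' : α} (hd : d ≠ d') (l l' : List α) :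
            (d :: l).Sublist (d' :: l') ↔ (d :: l).Sublist l' := by
          rw [List.sublist_cons_iff]
          simp [hd]
        simp [cons, shear, Fin.consEquiv, hc, cons_sublist (Ne.symm hc), cons_sublist hb, he₁]

theorem subsequence_containment_count_same_length (σ n m : ℕ)
    (x₁ x₂ : List (Fin σ)) (h₁ : x₁.length = m) (h₂ : x₂.length = m) (hmn : m ≤ n) :
    Nat.card {w : Fin n → Fin σ // x₁.Sublist (List.ofFn w)}
      = Nat.card {w : Fin n → Fin σ // x₂.Sublist (List.ofFn w)} := by
  obtain ⟨e, he⟩ := exists_perm_sublist_ofFn_iff n x₁ x₂ (h₁.trans h₂.symm)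
  exact Nat.card_congr (e.subtypeEquiv he)
end

section
/- Fix an alphabet Σ of size σ, and for a string x let C(ℓ, Σ, x) denote the number of strings of length ℓ over Σ that contain x as a subsequence. Then for any string y, any character c, and any ℓ ≥ |y| + 1, the recurrence C(ℓ+1, Σ, yc) = σ·C(ℓ, Σ, yc) + C(ℓ, Σ, y) − C(ℓ, Σ, yc) holds, where yc denotes the string y with the character c appended. -/
theorem List.append_singleton_sublist_append_singleton_iff {α : Type*} {y l : List α} {c a : α} :
    (y ++ [c]).Sublist (l ++ [a]) ↔ (y ++ [c]).Sublist l ∨ a = c ∧ y.Sublist l := by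
  rw [← List.reverse_sublist, ← List.reverse_sublist (l₂ := l), ← List.reverse_sublist (l₂ := l)]
  simp only [List.reverse_append, List.reverse_singleton, List.singleton_append,
    List.sublist_cons_iff, List.cons.injEq]
  grind

theorem List.ofFn_snoc {α : Type*} {n : ℕ} (w : Fin n → α) (a : α) :
    List.ofFn (Fin.snoc w a : Fin (n + 1) → α) = List.ofFn w ++ [a] := by
  rw [List.ofFn_succ']
  simp

/-- For `A ⊆ B`, the pairs `(a, w)` with `w ∈ A`, or `a = c` and `w ∈ B`, are counted by fibres
over `w`: the whole alphabet over `A`, and only `c` over `B \ A`. -/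
theorem card_prod_or_eq_and_add_card {α β : Type*} [Fintype α] [Fintype β] (A B : β → Prop)
    (hAB : ∀ w, A w → B w) (c : α) :
    Nat.card {p : α × β // A p.2 ∨ p.1 = c ∧ B p.2} + Nat.card {w // A w}
      = Fintype.card α * Nat.card {w // A w} + Nat.card {w // B w} := by
  classical
  simp only [Nat.card_eq_fintype_card, Fintype.card_subtype, Finset.card_filter,
    Fintype.sum_prod_type_right, Finset.mul_sum, ← Finset.sum_add_distrib]
  refine Finset.sum_congr rfl fun w _ => ?_
  by_cases hA : A w
  · simp [hA, hAB w hA]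
  · by_cases hB : B w <;> simp [hA, hB]

theorem subsequence_containment_count_recurrence (σ ℓ : ℕ) (y : List (Fin σ)) (c : Fin σ)
    (hℓ : y.length + 1 ≤ ℓ) :
    Nat.card {w : Fin (ℓ + 1) → Fin σ // (y ++ [c]).Sublist (List.ofFn w)}
      = σ * Nat.card {w : Fin ℓ → Fin σ // (y ++ [c]).Sublist (List.ofFn w)}
        + Nat.card {w : Fin ℓ → Fin σ // y.Sublist (List.ofFn w)}
        - Nat.card {w : Fin ℓ → Fin σ // (y ++ [c]).Sublist (List.ofFn w)} := by
  have hcount := card_prod_or_eq_and_add_card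
    (fun w : Fin ℓ → Fin σ => (y ++ [c]).Sublist (List.ofFn w))
    (fun w => y.Sublist (List.ofFn w)) (fun w => (List.sublist_append_left y [c]).trans) c
  rw [Fintype.card_fin] at hcount
  rw [← hcount, Nat.add_sub_cancel]
  refine (Nat.card_congr ((Fin.snocEquiv fun _ => Fin σ).subtypeEquiv fun p => ?_)).symm
  rw [← List.append_singleton_sublist_append_singleton_iff, ← List.ofFn_snoc]
  rfl
end

section
/- Let σ and n be positive integers with σ < n. The sum TDS(σ, n), over all σ^n strings w of length n over a totally ordered alphabet of size σ, of the number of distinct Lyndon words occurring as subsequences of w, satisfies TDS(σ, n) = Σ_{m=1}^{n} L(σ, m) · Σ_{k=m}^{n} C(n, k)·(σ − 1)^{n−k}, where L(σ, m) is the number of Lyndon words of length m over the alphabet. Consequently, the expected number of distinct Lyndon subsequences of a uniformly random string of length n is TDS(σ, n)/σ^n. -/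
/-- The number of Lyndon words of length `m` over the alphabet `Fin σ`. -/
noncomputable def numLyndon (σ m : ℕ) : ℕ :=
  Nat.card {x : List (Fin σ) // x.length = m ∧ IsLyndon x}

/-- The number of distinct Lyndon words occurring as subsequences of `w`. -/
noncomputable def distinctLyndonSubseq {α : Type*} [LinearOrder α] (w : List α) : ℕ :=
  Nat.card {x : List α // IsLyndon x ∧ x.Sublist w}

/-- The Pascal recurrence of the tail binomial sums
`∑ k ∈ [m, n], C(n, k) * s ^ (n - k)`. -/
theorem sum_choose_mul_pow_succ_succ (s n m : ℕ) :
    ∑ k ∈ Finset.Icc (m + 1) (n + 1), (n + 1).choose k * s ^ (n + 1 - k)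
      = (∑ k ∈ Finset.Icc m n, n.choose k * s ^ (n - k))
        + s * ∑ k ∈ Finset.Icc (m + 1) n, n.choose k * s ^ (n - k) := by
  have hshift : ∀ f : ℕ → ℕ, ∑ k ∈ Finset.Icc (m + 1) (n + 1), f k
      = ∑ k ∈ Finset.Icc m n, f (k + 1) := fun f => by
    rw [← Finset.image_add_right_Icc m n 1, Finset.sum_image (by simp)]
  have htail : s * ∑ k ∈ Finset.Icc (m + 1) n, n.choose k * s ^ (n - k)
      = ∑ k ∈ Finset.Icc (m + 1) (n + 1), n.choose k * s ^ (n + 1 - k) := by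
    have hsub : Finset.Icc (m + 1) n ⊆ Finset.Icc (m + 1) (n + 1) :=
      Finset.Icc_subset_Icc_right (Nat.le_succ n)
    rw [← Finset.sum_subset hsub, Finset.mul_sum]
    · refine Finset.sum_congr rfl fun k hk => ?_
      rw [Nat.succ_sub (Finset.mem_Icc.mp hk).2, pow_succ]
      ring
    · intro k hk hk'
      rw [Nat.choose_eq_zero_of_lt, zero_mul]
      simp only [Finset.mem_Icc] at hk hk'
      omega
  rw [htail, hshift, hshift, ← Finset.sum_add_distrib]
  refine Finset.sum_congr rfl fun k _ => ?_
  rw [Nat.choose_succ_succ, Nat.succ_sub_succ, add_mul]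

/-- The number of strings of length `n` containing a given word as a subsequence
depends only on the length of that word. -/
theorem card_filter_sublist_ofFn {σ : ℕ} (hσ : 0 < σ) (n : ℕ) (x : List (Fin σ)) :
    (Finset.univ.filter fun w : Fin n → Fin σ => x.Sublist (List.ofFn w)).card
      = ∑ k ∈ Finset.Icc x.length n, n.choose k * (σ - 1) ^ (n - k) := by
  induction n generalizing x with
  | zero => cases x <;> simp
  | succ n ih =>
    cases x with
    | nil =>
      have hbinom := add_pow 1 (σ - 1) (n + 1)
      rw [Nat.add_sub_cancel' hσ, Finset.range_eq_Ico] at hbinom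
      simpa [mul_comm, Finset.Ico_add_one_right_eq_Icc] using hbinom
    | cons a x =>
      have hhead : ∀ b : Fin σ,
          (∑ w : Fin n → Fin σ,
            if (a :: x).Sublist (List.ofFn (Fin.cons b w : Fin (n + 1) → Fin σ))
            then 1 else 0)
          = if b = a then ∑ k ∈ Finset.Icc x.length n, n.choose k * (σ - 1) ^ (n - k)
            else ∑ k ∈ Finset.Icc (x.length + 1) n, n.choose k * (σ - 1) ^ (n - k) := by
        intro b
        split_ifs with h
        · subst h
          simp only [List.ofFn_cons, List.cons_sublist_cons]
          rw [← Finset.card_filter, ih]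
        · have hskip : ∀ l : List (Fin σ), (a :: x).Sublist (b :: l) ↔ (a :: x).Sublist l :=
            fun l => ⟨fun hl => by cases hl <;> trivial, fun hl => hl.cons b⟩
          simp only [List.ofFn_cons, hskip]
          rw [← Finset.card_filter, ih, List.length_cons]
      rw [Finset.card_filter, ← (Fin.consEquiv fun _ => Fin σ).sum_comp, Fintype.sum_prod_type]
      refine (Finset.sum_congr rfl fun b _ => hhead b).trans ?_
      rw [Finset.sum_ite, Finset.sum_const, Finset.sum_const, List.length_cons,
        sum_choose_mul_pow_succ_succ]
      simp [Finset.filter_ne', Finset.filter_eq']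

open Classical in
/-- The Lyndon words of length `m` over `Fin σ`, as a finite set. -/
noncomputable def lyndonWords (σ m : ℕ) : Finset (List (Fin σ)) :=
  (List.finite_length_eq (Fin σ) m).toFinset.filter IsLyndon

theorem mem_lyndonWords {σ m : ℕ} {x : List (Fin σ)} :
    x ∈ lyndonWords σ m ↔ x.length = m ∧ IsLyndon x := by
  simp [lyndonWords]

theorem card_lyndonWords (σ m : ℕ) : (lyndonWords σ m).card = numLyndon σ m := by
  rw [numLyndon, Nat.subtype_card _ fun x => mem_lyndonWords]

/-- The distinct Lyndon subsequences of a string of length `n`, counted by length. -/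
theorem distinctLyndonSubseq_ofFn {σ n : ℕ} (w : Fin n → Fin σ) :
    distinctLyndonSubseq (List.ofFn w)
      = ∑ m ∈ Finset.Icc 1 n, ∑ x ∈ lyndonWords σ m,
          if x.Sublist (List.ofFn w) then 1 else 0 := by
  have hdisj : Set.PairwiseDisjoint (Finset.Icc 1 n : Set ℕ) (lyndonWords σ) := by
    intro i _ j _ hij
    refine Finset.disjoint_left.mpr fun x hi hj => hij ?_
    rw [← (mem_lyndonWords.mp hi).1, (mem_lyndonWords.mp hj).1]
  rw [← Finset.sum_biUnion hdisj, ← Finset.card_filter, distinctLyndonSubseq]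
  refine Nat.subtype_card _ fun x => ?_
  simp only [Finset.mem_filter, Finset.mem_biUnion, Finset.mem_Icc, mem_lyndonWords]
  constructor
  · rintro ⟨⟨m, -, -, hx⟩, hxw⟩
    exact ⟨hx, hxw⟩
  · rintro ⟨hx, hxw⟩
    have hlen := hxw.length_le
    rw [List.length_ofFn] at hlen
    exact ⟨⟨x.length, ⟨List.length_pos_iff.mpr hx.1, hlen⟩, rfl, hx⟩, hxw⟩

theorem expected_distinct_lyndon_subsequences (σ n : ℕ) (hσ : 0 < σ) (hσn : σ < n) :
    (∑ w : Fin n → Fin σ, distinctLyndonSubseq (List.ofFn w))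
      = ∑ m ∈ Finset.Icc 1 n,
          numLyndon σ m * ∑ k ∈ Finset.Icc m n, n.choose k * (σ - 1) ^ (n - k) ∧
    (∑ w : Fin n → Fin σ, (distinctLyndonSubseq (List.ofFn w) : ℚ)) / (σ : ℚ) ^ n
      = ((∑ m ∈ Finset.Icc 1 n,
            numLyndon σ m * ∑ k ∈ Finset.Icc m n, n.choose k * (σ - 1) ^ (n - k) : ℕ) : ℚ)
          / (σ : ℚ) ^ n := by
  have htotal : (∑ w : Fin n → Fin σ, distinctLyndonSubseq (List.ofFn w))
      = ∑ m ∈ Finset.Icc 1 n,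
          numLyndon σ m * ∑ k ∈ Finset.Icc m n, n.choose k * (σ - 1) ^ (n - k) := by
    simp only [distinctLyndonSubseq_ofFn]
    rw [Finset.sum_comm]
    refine Finset.sum_congr rfl fun m _ => ?_
    rw [Finset.sum_comm, ← card_lyndonWords, ← smul_eq_mul, ← Finset.sum_const]
    refine Finset.sum_congr rfl fun x hx => ?_
    rw [← Finset.card_filter, card_filter_sublist_ofFn hσ, (mem_lyndonWords.mp hx).1]
  exact ⟨htotal, by rw [← htotal, Nat.cast_sum]⟩
end

section
/- For any Lyndon word x of length m over a totally ordered alphabet of size σ and any n ≥ m, the number of strings of length n over the alphabet that contain x as a subsequence equals Σ_{k=m}^{n} C(n, k)·(σ − 1)^{n−k}; in particular this number does not depend on the choice of the Lyndon word x of length m. -/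
open Finset in
/-- Pascal-type recursion for the tails of the binomial expansion of `(s + 1) ^ n`. -/
theorem sum_Icc_choose_mul_pow_succ (s n m : ℕ) :
    ∑ k ∈ Icc (m + 1) (n + 1), (n + 1).choose k * s ^ (n + 1 - k)
      = ∑ k ∈ Icc m n, n.choose k * s ^ (n - k)
        + s * ∑ k ∈ Icc (m + 1) n, n.choose k * s ^ (n - k) := by
  have hshift (f : ℕ → ℕ) : ∑ k ∈ Icc (m + 1) (n + 1), f k = ∑ k ∈ Icc m n, f (k + 1) := by
    rw [← Finset.map_add_right_Icc, sum_map]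
    rfl
  have hextend : ∑ k ∈ Icc (m + 1) n, n.choose k * s ^ (n - k)
      = ∑ k ∈ Icc (m + 1) (n + 1), n.choose k * s ^ (n - k) := by
    refine sum_subset (Icc_subset_Icc_right n.le_succ) fun k hk hk' => ?_
    rw [mem_Icc] at hk hk'
    rw [Nat.choose_eq_zero_of_lt (by omega), zero_mul]
  rw [hextend, hshift, hshift, mul_sum, ← sum_add_distrib]
  refine sum_congr rfl fun k hk => ?_
  rw [Nat.choose_succ_succ, Nat.add_sub_add_right, add_mul]
  congr 1
  obtain rfl | hlt := (mem_Icc.mp hk).2.eq_or_lt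
  · simp
  · rw [show n - k = n - (k + 1) + 1 by omega, pow_succ]
    ring

theorem List.cons_sublist_cons_of_ne {α : Type*} {a b : α} (h : a ≠ b) (x w : List α) :
    (a :: x).Sublist (b :: w) ↔ (a :: x).Sublist w := by
  rw [List.sublist_cons_iff]
  simp [h]

/-- Counting the words of length `n + 1` that contain `a :: x`, by their first letter. -/
theorem card_cons_sublist_ofFn_succ {α : Type*} [Fintype α] (a : α) (x : List α) (n : ℕ) :
    Nat.card {w : Fin (n + 1) → α // (a :: x).Sublist (List.ofFn w)}
      = Nat.card {w : Fin n → α // x.Sublist (List.ofFn w)}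
        + (Fintype.card α - 1) * Nat.card {w : Fin n → α // (a :: x).Sublist (List.ofFn w)} := by
  classical
  let e : {w : Fin (n + 1) → α // (a :: x).Sublist (List.ofFn w)}
      ≃ Σ b : α, {w : Fin n → α // (a :: x).Sublist (b :: List.ofFn w)} :=
    ((Fin.consEquiv fun _ => α).symm.subtypeEquiv fun w => by
      rw [List.ofFn_succ]; rfl).trans
      (Equiv.subtypeProdEquivSigmaSubtype fun b (w : Fin n → α) =>
        (a :: x).Sublist (b :: List.ofFn w))
  rw [Nat.card_congr e, Nat.card_sigma, ← Finset.add_sum_erase _ _ (Finset.mem_univ a)]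
  congr 1
  · simp only [List.cons_sublist_cons]
  · rw [Finset.sum_const_nat
      (m := Nat.card {w : Fin n → α // (a :: x).Sublist (List.ofFn w)}) fun b hb => by
        simp only [List.cons_sublist_cons_of_ne (Finset.ne_of_mem_erase hb).symm],
      Finset.card_erase_of_mem (Finset.mem_univ a), Finset.card_univ]

/-- The number of words of length `n` containing `x` as a subsequence depends on `x` only
through its length. -/
theorem card_sublist_ofFn {α : Type*} [Fintype α] [Nonempty α] (n : ℕ) (x : List α) :
    Nat.card {w : Fin n → α // x.Sublist (List.ofFn w)}
      = ∑ k ∈ Finset.Icc x.length n, n.choose k * (Fintype.card α - 1) ^ (n - k) := by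
  induction n generalizing x with
  | zero => cases x <;> simp
  | succ n ih =>
    cases x with
    | nil =>
      have hcard : Fintype.card α = 1 + (Fintype.card α - 1) :=
        (Nat.add_sub_cancel' Fintype.card_pos).symm
      have hpow := add_pow 1 (Fintype.card α - 1) (n + 1)
      rw [← hcard] at hpow
      simp [Nat.card_eq_fintype_card, hpow, Nat.range_succ_eq_Icc_zero, mul_comm]
    | cons a x =>
      rw [card_cons_sublist_ofFn_succ, ih, ih, List.length_cons, sum_Icc_choose_mul_pow_succ]

theorem count_strings_containing_lyndon_word (σ n m : ℕ) (x : List (Fin σ))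
    (hlyndon : IsLyndon x) (hx : x.length = m) (hmn : m ≤ n) :
    Nat.card {w : Fin n → Fin σ // x.Sublist (List.ofFn w)}
      = ∑ k ∈ Finset.Icc m n, n.choose k * (σ - 1) ^ (n - k) := by
  have : Nonempty (Fin σ) := ⟨x.head hlyndon.1⟩
  rw [card_sublist_ofFn, hx, Fintype.card_fin]
end
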